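/- Let (H,R) be a finite-dimensional quasi-triangular Hopf algebra over a field k, let Λ be a left integral for H, let α be the distinguished grouplike element of H*, let u = Σ S(R²)R¹ be the Drinfeld element, and let α̃ = (α⊗id)(R) ∈ H. Write Δ_R(Λ) = Σ Λ⁽¹⁾⊗Λ⁽²⁾. Then Σ Λ⁽¹⁾⊗Λ⁽²⁾ = Σ Λ⁽²⁾⊗Λ⁽¹⁾ holds if and only if Σ Λ₍₁₎(S(u))α̃ ⊗ Λ₍₂₎ = Σ α̃(S(u))Λ₍₁₎ ⊗ Λ₍₂₎. -/

import Mathlib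

open TensorProduct LinearMap

variable (K : Type) [Field K] (H : Type) [Ring H] [HopfAlgebra K H]

/-- The left adjoint action as a linear map `H ⊗ H →ₗ H`, `h ⊗ a ↦ Σ h₍₁₎ * a * S(h₍₂₎)`. -/
noncomputable def adMap : H ⊗[K] H →ₗ[K] H :=
  (LinearMap.mul' K H) ∘ₗ
    (LinearMap.lTensor H ((LinearMap.mul' K H) ∘ₗ
      (LinearMap.lTensor H (HopfAlgebra.antipode (R := K))) ∘ₗ
      (TensorProduct.comm K H H).toLinearMap)) ∘ₗ
    (TensorProduct.assoc K H H H).toLinearMap ∘ₗ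
    (LinearMap.rTensor H (Coalgebra.comul (R := K)))

/-- `h ·_ad a = Σ h₍₁₎ a S(h₍₂₎)`. -/
noncomputable def adAct (h a : H) : H := adMap K H (h ⊗ₜ a)

/-- `R¹² = Σ r¹ ⊗ r² ⊗ 1` in `H ⊗ (H ⊗ H)`. -/
noncomputable def r12 (R : H ⊗[K] H) : H ⊗[K] (H ⊗[K] H) :=
  TensorProduct.map LinearMap.id ((TensorProduct.mk K H H).flip 1) R

/-- `R¹³ = Σ r¹ ⊗ 1 ⊗ r²` in `H ⊗ (H ⊗ H)`. -/
noncomputable def r13 (R : H ⊗[K] H) : H ⊗[K] (H ⊗[K] H) :=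
  TensorProduct.map LinearMap.id (TensorProduct.mk K H H 1) R

/-- `R²³ = 1 ⊗ R` in `H ⊗ (H ⊗ H)`. -/
noncomputable def r23 (R : H ⊗[K] H) : H ⊗[K] (H ⊗[K] H) := (1 : H) ⊗ₜ R

/-- `(H,R)` is a quasi-triangular Hopf algebra: `R` is invertible,
`R Δ(h) = Δᶜᵒᵖ(h) R`, `(Δ⊗id)(R) = R¹³R²³` and `(id⊗Δ)(R) = R¹³R¹²`. -/
structure IsQuasiTriangular (R : H ⊗[K] H) : Prop where
  isUnit : IsUnit R
  intertwine : ∀ h : H, R * Coalgebra.comul h =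
    (TensorProduct.comm K H H) (Coalgebra.comul h) * R
  comul_rTensor : (TensorProduct.assoc K H H H)
      ((LinearMap.rTensor H (Coalgebra.comul (R := K))) R) = r13 K H R * r23 K H R
  comul_lTensor : (LinearMap.lTensor H (Coalgebra.comul (R := K))) R = r13 K H R * r12 K H R

/-- The comultiplication `Δ_R` of the transmuted braided group `H_R`:
`Δ_R(h) = Σ h₍₁₎ S(R²) ⊗ R¹ ·_ad h₍₂₎`. -/
noncomputable def deltaR (R : H ⊗[K] H) : H →ₗ[K] H ⊗[K] H :=
  (TensorProduct.map
      ((LinearMap.mul' K H) ∘ₗ (LinearMap.lTensor H (HopfAlgebra.antipode (R := K))))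
      ((adMap K H) ∘ₗ (TensorProduct.comm K H H).toLinearMap)) ∘ₗ
    (TensorProduct.tensorTensorTensorComm K H H H H).toLinearMap ∘ₗ
    (LinearMap.lTensor (H ⊗[K] H) (TensorProduct.comm K H H).toLinearMap) ∘ₗ
    ((TensorProduct.mk K (H ⊗[K] H) (H ⊗[K] H)).flip R) ∘ₗ
    (Coalgebra.comul (R := K))

/-- The Drinfeld element `u = Σ S(R²) R¹`. -/
noncomputable def drinfeldU (R : H ⊗[K] H) : H :=
  (LinearMap.mul' K H) ((TensorProduct.comm K H H)
    ((LinearMap.lTensor H (HopfAlgebra.antipode (R := K))) R))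

/-- `α̃ = (α ⊗ id)(R) ∈ H`, for `α : H → k`. -/
noncomputable def alphaTilde (α : H →ₐ[K] K) (R : H ⊗[K] H) : H :=
  (TensorProduct.lid K H) ((TensorProduct.map α.toLinearMap LinearMap.id) R)

/-- `Λ` is a left integral for `H`: `hΛ = ε(h)Λ` for all `h`. -/
def IsLeftIntegral (Λ : H) : Prop := ∀ h : H, h * Λ = (Coalgebra.counit (R := K) h) • Λ

section Convolution

open Coalgebra HopfAlgebra WithConv Algebra.TensorProduct MulOpposite

variable {K H}
variable {A : Type} [Ring A] [Algebra K A]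

lemma toConv_algHom_antipode_mul (φ : H →ₐ[K] A) :
    toConv (φ.toLinearMap ∘ₗ antipode K) * toConv φ.toLinearMap = 1 := by
  have h := algHom_comp_convMul_distrib φ (toConv (antipode K (A := H))) (toConv LinearMap.id)
  rw [antipode_mul_id] at h
  apply WithConv.ofConv_injective
  simp only [LinearMap.comp_id] at h
  rw [← h]
  ext x
  simp [LinearMap.convOne_def]

lemma toConv_algHom_mul_antipode (φ : H →ₐ[K] A) :
    toConv φ.toLinearMap * toConv (φ.toLinearMap ∘ₗ antipode K) = 1 := by
  have h := algHom_comp_convMul_distrib φ (toConv LinearMap.id) (toConv (antipode K (A := H)))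
  rw [id_mul_antipode] at h
  apply WithConv.ofConv_injective
  simp only [LinearMap.comp_id] at h
  rw [← h]
  ext x
  simp [LinearMap.convOne_def]

lemma toConv_comul :
    toConv (comul (R := K) (A := H)) =
      toConv (includeLeft : H →ₐ[K] H ⊗[K] H).toLinearMap *
        toConv (includeRight : H →ₐ[K] H ⊗[K] H).toLinearMap := by
  ext x
  rw [(ℛ K x).convMul_apply]
  simp [← (ℛ K x).eq]

lemma sum_counit_smul_left {κ : Type} {x : H} (r : Repr K x κ) :
    ∑ i ∈ r.index, counit (R := K) (r.right i) • r.left i = x := by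
  have := congr(TensorProduct.rid K H $(sum_tmul_counit_eq (R := K) r))
  simpa only [map_sum, TensorProduct.rid_tmul, one_smul] using this

variable {ι : Type} {s : Finset ι} {a b : ι → H}

lemma IsQuasiTriangular.sum_conv_tmul (hR : IsQuasiTriangular K H (∑ i ∈ s, a i ⊗ₜ b i))
    (f g : H →ₗ[K] A) :
    ∑ i ∈ s, (toConv f * toConv g) (a i) ⊗ₜ[K] b i =
      ∑ i ∈ s, ∑ j ∈ s, (f (a i) * g (a j)) ⊗ₜ[K] (b i * b j) := by
  have h := congr(LinearMap.rTensor H (mul' K A ∘ₗ TensorProduct.map f g)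
    ((TensorProduct.assoc K H H H).symm $(hR.comul_rTensor)))
  simpa [r13, r23, TensorProduct.tmul_sum, Finset.sum_mul_sum] using h

lemma IsQuasiTriangular.sum_tmul_conv (hR : IsQuasiTriangular K H (∑ i ∈ s, a i ⊗ₜ b i))
    (f g : H →ₗ[K] A) :
    ∑ i ∈ s, a i ⊗ₜ[K] (toConv f * toConv g) (b i) =
      ∑ i ∈ s, ∑ j ∈ s, (a i * a j) ⊗ₜ[K] (f (b j) * g (b i)) := by
  have h := congr(LinearMap.lTensor H (mul' K A ∘ₗ TensorProduct.map f g)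
    $(hR.comul_lTensor))
  simpa [r13, r12, Finset.sum_mul_sum] using h

lemma IsQuasiTriangular.sum_counit_tmul (hR : IsQuasiTriangular K H (∑ i ∈ s, a i ⊗ₜ b i)) :
    ∑ i ∈ s, algebraMap K H (counit (a i)) ⊗ₜ[K] b i = 1 := by
  have h := hR.sum_conv_tmul (1 : WithConv (H →ₗ[K] H)).ofConv (1 : WithConv (H →ₗ[K] H)).ofConv
  have hu := hR.isUnit.map (Algebra.TensorProduct.map
    ((Algebra.ofId K H).comp (Bialgebra.counitAlgHom K H)) (AlgHom.id K H))
  simp only [map_sum, Algebra.TensorProduct.map_tmul, AlgHom.comp_apply, Algebra.ofId_apply,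
    Bialgebra.counitAlgHom_apply, AlgHom.id_apply] at hu
  simp only [toConv_ofConv, mul_one] at h
  refine hu.mul_left_cancel ?_
  rw [mul_one, Finset.sum_mul_sum]
  simpa using h.symm

lemma IsQuasiTriangular.sum_tmul_counit (hR : IsQuasiTriangular K H (∑ i ∈ s, a i ⊗ₜ b i)) :
    ∑ i ∈ s, a i ⊗ₜ[K] algebraMap K H (counit (b i)) = 1 := by
  have h := hR.sum_tmul_conv (1 : WithConv (H →ₗ[K] H)).ofConv (1 : WithConv (H →ₗ[K] H)).ofConv
  have hu := hR.isUnit.map (Algebra.TensorProduct.map (AlgHom.id K H)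
    ((Algebra.ofId K H).comp (Bialgebra.counitAlgHom K H)))
  simp only [map_sum, Algebra.TensorProduct.map_tmul, AlgHom.comp_apply, Algebra.ofId_apply,
    Bialgebra.counitAlgHom_apply, AlgHom.id_apply] at hu
  simp only [toConv_ofConv, mul_one] at h
  refine hu.mul_left_cancel ?_
  rw [mul_one, Finset.sum_mul_sum]
  simpa [← map_mul, mul_comm] using h.symm

lemma IsQuasiTriangular.antipode_tmul_mul (hR : IsQuasiTriangular K H (∑ i ∈ s, a i ⊗ₜ b i)) :
    (∑ i ∈ s, antipode K (a i) ⊗ₜ[K] b i) * ∑ i ∈ s, a i ⊗ₜ[K] b i = 1 := by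
  have h := hR.sum_conv_tmul (antipode K) LinearMap.id
  rw [antipode_mul_id] at h
  simp only [LinearMap.convOne_apply, hR.sum_counit_tmul] at h
  simpa [Finset.sum_mul_sum] using h.symm

lemma IsQuasiTriangular.sum_tmul_mul_antipode
    (hR : IsQuasiTriangular K H (∑ i ∈ s, a i ⊗ₜ b i)) :
    ∑ i ∈ s, ∑ j ∈ s, (a i * a j) ⊗ₜ[K] (b j * antipode K (b i)) = 1 := by
  have h := hR.sum_tmul_conv LinearMap.id (antipode K)
  rw [id_mul_antipode] at h
  simp only [LinearMap.convOne_apply, hR.sum_tmul_counit] at h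
  simpa using h.symm

lemma IsQuasiTriangular.sum_antipode_tmul_antipode
    (hR : IsQuasiTriangular K H (∑ i ∈ s, a i ⊗ₜ b i)) :
    ∑ i ∈ s, antipode K (a i) ⊗ₜ[K] antipode K (b i) = ∑ i ∈ s, a i ⊗ₜ[K] b i := by
  have h := congr(TensorProduct.map (antipode K) LinearMap.id $(hR.sum_tmul_mul_antipode))
  simp only [map_sum, TensorProduct.map_tmul, antipode_mul_antidistrib, LinearMap.id_apply,
    Algebra.TensorProduct.one_def, antipode_one] at h
  rw [← Algebra.TensorProduct.one_def] at h
  have h' : (∑ i ∈ s, antipode K (a i) ⊗ₜ[K] b i) *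
      ∑ i ∈ s, antipode K (a i) ⊗ₜ[K] antipode K (b i) = 1 := by
    rw [Finset.sum_mul_sum, Finset.sum_comm]
    simpa using h
  have hinv := hR.antipode_tmul_mul
  obtain ⟨U, hU⟩ := hR.isUnit
  rw [← hU] at hinv ⊢
  rw [left_inv_eq_right_inv hinv U.mul_inv] at h'
  exact (Units.inv_mul_eq_one.1 h').symm

lemma drinfeldU_sum : drinfeldU K H (∑ i ∈ s, a i ⊗ₜ b i) = ∑ i ∈ s, antipode K (b i) * a i := by
  simp [drinfeldU]

lemma alphaTilde_sum (α : H →ₐ[K] K) :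
    alphaTilde K H α (∑ i ∈ s, a i ⊗ₜ b i) = ∑ i ∈ s, α (a i) • b i := by
  simp [alphaTilde]

lemma IsQuasiTriangular.antipode_drinfeldU
    (hR : IsQuasiTriangular K H (∑ i ∈ s, a i ⊗ₜ b i)) :
    antipode K (drinfeldU K H (∑ i ∈ s, a i ⊗ₜ b i)) = ∑ i ∈ s, a i * antipode K (b i) := by
  have h := congr(mul' K H (TensorProduct.map LinearMap.id (antipode K)
    $(hR.sum_antipode_tmul_antipode)))
  simpa [drinfeldU_sum, antipode_mul_antidistrib] using h

lemma IsQuasiTriangular.sum_antipode_mul_drinfeldU_mul {R : H ⊗[K] H}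
    (hR : IsQuasiTriangular K H R) (x : H) :
    ∑ j ∈ (ℛ K x).index, antipode K ((ℛ K x).right j) * drinfeldU K H R * (ℛ K x).left j =
      counit (R := K) x • drinfeldU K H R := by
  obtain ⟨s, rfl⟩ := TensorProduct.exists_finset R
  have h := hR.intertwine x
  rw [← (ℛ K x).eq] at h
  have h := congr(mul' K H (TensorProduct.map (antipode K) LinearMap.id
    (TensorProduct.comm K H H $h)))
  simp only [Finset.sum_mul_sum, map_sum, Algebra.TensorProduct.tmul_mul_tmul,
    TensorProduct.comm_tmul, TensorProduct.map_tmul, LinearMap.id_apply, mul'_apply,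
    antipode_mul_antidistrib] at h
  rw [drinfeldU_sum]
  simp only [Finset.mul_sum, Finset.sum_mul, Finset.smul_sum]
  rw [Finset.sum_comm]
  simp only [mul_assoc] at h ⊢
  rw [h, Finset.sum_comm]
  refine Finset.sum_congr rfl fun i _ => ?_
  have h2 := sum_antipode_mul_eq_smul (ℛ K x)
  simp only [← Finset.mul_sum, ← mul_assoc (antipode K _) _ i.1, ← Finset.sum_mul]
  rw [h2]
  simp

lemma IsQuasiTriangular.drinfeldU_mul {R : H ⊗[K] H} (hR : IsQuasiTriangular K H R) (x : H) :
    drinfeldU K H R * x = antipode K (antipode K x) * drinfeldU K H R := by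
  let o : H →ₗ[K] Hᵐᵒᵖ := (opLinearEquiv K).toLinearMap
  let f₁ : WithConv (H →ₗ[K] Hᵐᵒᵖ) := toConv (o ∘ₗ mulLeft K (drinfeldU K H R))
  let f₂ : WithConv (H →ₗ[K] Hᵐᵒᵖ) := toConv (antipodeAlgHomOp K H).toLinearMap
  let f₃ : WithConv (H →ₗ[K] Hᵐᵒᵖ) :=
    toConv ((antipodeAlgHomOp K H).toLinearMap ∘ₗ antipode K)
  have h23 : f₂ * f₃ = 1 := toConv_algHom_mul_antipode _
  have h12 : f₁ * f₂ = toConv (toSpanSingleton K Hᵐᵒᵖ (op (drinfeldU K H R)) ∘ₗ counit) := by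
    ext x
    rw [(ℛ K x).convMul_apply]
    have := congr(op $(hR.sum_antipode_mul_drinfeldU_mul x))
    simpa [f₁, f₂, o, mul_assoc] using this
  have h : f₁ = toConv (toSpanSingleton K Hᵐᵒᵖ (op (drinfeldU K H R)) ∘ₗ counit) * f₃ := by
    rw [← h12, mul_assoc, h23, mul_one]
  have hx := congr($h x)
  rw [(ℛ K x).convMul_apply] at hx
  have hx := congr(unop $hx)
  have h2 := congr(antipode K (antipode K $(sum_counit_smul (ℛ K x))))
  simp only [map_sum, map_smul] at h2
  rw [← h2]
  simpa [f₁, f₃, o, Finset.sum_mul] using hx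

lemma IsQuasiTriangular.isUnit_drinfeldU [FiniteDimensional K H] {R : H ⊗[K] H}
    (hR : IsQuasiTriangular K H R) : IsUnit (drinfeldU K H R) := by
  obtain ⟨s, rfl⟩ := TensorProduct.exists_finset R
  have : IsArtinianRing H := IsArtinianRing.of_finite K H
  have : IsArtinianRing (H ⊗[K] H) := IsArtinianRing.of_finite K _
  refine IsUnit.of_mul_eq_one (∑ i ∈ s, i.2 * antipode K (antipode K i.1)) ?_
  have h := mul_eq_one_symm hR.antipode_tmul_mul
  rw [← hR.sum_antipode_tmul_antipode] at h
  have h1 := congr(TensorProduct.map (antipode K) LinearMap.id $(hR.sum_antipode_tmul_antipode))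
  simp only [map_sum, TensorProduct.map_tmul, LinearMap.id_apply] at h1
  rw [hR.sum_antipode_tmul_antipode, ← h1] at h
  have h := congr(mul' K H (TensorProduct.map (antipode K) LinearMap.id
    (TensorProduct.comm K H H $h)))
  simp only [Finset.sum_mul_sum, map_sum, Algebra.TensorProduct.tmul_mul_tmul,
    TensorProduct.comm_tmul, TensorProduct.map_tmul, LinearMap.id_apply, mul'_apply,
    antipode_mul_antidistrib, Algebra.TensorProduct.one_def, antipode_one, mul_one] at h
  rw [← h, Finset.mul_sum, Finset.sum_comm]
  refine Finset.sum_congr rfl fun i _ => ?_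
  rw [← mul_assoc, hR.drinfeldU_mul, drinfeldU_sum]
  simp [Finset.mul_sum, Finset.sum_mul, mul_assoc]

lemma IsQuasiTriangular.antipode_antipode_surjective [FiniteDimensional K H] {R : H ⊗[K] H}
    (hR : IsQuasiTriangular K H R) : Function.Surjective (antipode K ∘ₗ antipode K (A := H)) := by
  rw [← LinearMap.injective_iff_surjective]
  intro x y hxy
  refine hR.isUnit_drinfeldU.mul_left_cancel ?_
  rw [hR.drinfeldU_mul, hR.drinfeldU_mul]
  exact congr($hxy * _)

lemma IsQuasiTriangular.antipode_drinfeldU_mul [FiniteDimensional K H] {R : H ⊗[K] H}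
    (hR : IsQuasiTriangular K H R) (x : H) :
    antipode K (drinfeldU K H R) * antipode K (antipode K x) =
      x * antipode K (drinfeldU K H R) := by
  obtain ⟨y, rfl⟩ := hR.antipode_antipode_surjective x
  have h := congr(antipode K $(hR.drinfeldU_mul (antipode K y)))
  simpa only [antipode_mul_antidistrib, LinearMap.comp_apply] using h.symm

lemma IsQuasiTriangular.drinfeldU_mul_antipode_comm [FiniteDimensional K H] {R : H ⊗[K] H}
    (hR : IsQuasiTriangular K H R) (x : H) :
    drinfeldU K H R * antipode K (drinfeldU K H R) * x =
      x * (drinfeldU K H R * antipode K (drinfeldU K H R)) := by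
  obtain ⟨y, rfl⟩ := hR.antipode_antipode_surjective x
  simp only [LinearMap.comp_apply]
  rw [mul_assoc, hR.antipode_drinfeldU_mul, ← mul_assoc, ← mul_assoc, hR.drinfeldU_mul]

section Character

variable (α : H →ₐ[K] K)

/-- The linear map `h ↦ Σ α(S(h₍₁₎)) h₍₂₎`. -/
noncomputable def antipodeTwist : H →ₗ[K] H :=
  (toConv (((Algebra.ofId K H).comp α).toLinearMap ∘ₗ antipode K) *
    toConv LinearMap.id : WithConv (H →ₗ[K] H)).ofConv

lemma antipodeTwist_apply (x : H) :
    antipodeTwist α x = ∑ i ∈ (ℛ K x).index,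
      α (antipode K ((ℛ K x).left i)) • (ℛ K x).right i := by
  refine ((ℛ K x).convMul_apply _ _).trans ?_
  simp [Algebra.smul_def, Algebra.ofId_apply]

/-- The element `(id ⊗ f)(R) = Σ f(b) a`, for `R = Σ a ⊗ b`. -/
noncomputable def rightEval (f : H →ₗ[K] K) (R : H ⊗[K] H) : H :=
  TensorProduct.rid K H (LinearMap.lTensor H f R)

lemma rightEval_sum (f : H →ₗ[K] K) :
    rightEval f (∑ i ∈ s, a i ⊗ₜ b i) = ∑ i ∈ s, f (b i) • a i := by
  simp [rightEval]

lemma IsQuasiTriangular.sum_tmul_antipodeTwist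
    (hR : IsQuasiTriangular K H (∑ i ∈ s, a i ⊗ₜ b i)) :
    ∑ i ∈ s, a i ⊗ₜ[K] antipodeTwist α (b i) =
      ∑ i ∈ s, (a i * rightEval (α.toLinearMap ∘ₗ antipode K) (∑ i ∈ s, a i ⊗ₜ b i)) ⊗ₜ[K] b i := by
  rw [rightEval_sum]
  refine (hR.sum_tmul_conv _ _).trans ?_
  simp [Finset.mul_sum, TensorProduct.sum_tmul, Algebra.ofId_apply, ← Algebra.smul_def,
    TensorProduct.smul_tmul]

lemma IsQuasiTriangular.sum_antipodeTwist_mul_antipode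
    (hR : IsQuasiTriangular K H (∑ i ∈ s, a i ⊗ₜ b i)) :
    ∑ i ∈ s, antipodeTwist α (a i) * antipode K (b i) =
      antipode K (drinfeldU K H (∑ i ∈ s, a i ⊗ₜ b i)) *
        alphaTilde K H α (∑ i ∈ s, a i ⊗ₜ b i) := by
  have h := congr(mul' K H (TensorProduct.map LinearMap.id (antipode K)
    $(hR.sum_conv_tmul (((Algebra.ofId K H).comp α).toLinearMap ∘ₗ antipode K) LinearMap.id)))
  simp only [map_sum, TensorProduct.map_tmul, mul'_apply, LinearMap.id_apply] at h
  refine h.trans ?_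
  nth_rw 2 [← hR.sum_antipode_tmul_antipode]
  rw [hR.antipode_drinfeldU, alphaTilde_sum, Finset.sum_mul_sum, Finset.sum_comm]
  simp [Algebra.ofId_apply, ← Algebra.smul_def, antipode_mul_antidistrib, mul_assoc]

lemma IsQuasiTriangular.antipode_rightEval
    (hR : IsQuasiTriangular K H (∑ i ∈ s, a i ⊗ₜ b i)) :
    antipode K (rightEval (α.toLinearMap ∘ₗ antipode K) (∑ i ∈ s, a i ⊗ₜ b i)) =
      rightEval α.toLinearMap (∑ i ∈ s, a i ⊗ₜ b i) := by
  nth_rw 2 [← hR.sum_antipode_tmul_antipode]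
  simp [rightEval_sum]

lemma IsQuasiTriangular.rightEval_mul_rightEval
    (hR : IsQuasiTriangular K H (∑ i ∈ s, a i ⊗ₜ b i)) :
    rightEval (α.toLinearMap ∘ₗ antipode K) (∑ i ∈ s, a i ⊗ₜ b i) *
      rightEval α.toLinearMap (∑ i ∈ s, a i ⊗ₜ b i) = 1 := by
  have h := congr(TensorProduct.rid K H (LinearMap.lTensor H α.toLinearMap
    $(hR.sum_tmul_mul_antipode)))
  rw [rightEval_sum, rightEval_sum, Finset.sum_mul_sum]
  simpa [Algebra.TensorProduct.one_def, smul_smul, mul_comm] using h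

lemma IsQuasiTriangular.alphaTilde_mul_rightEval_comm {R : H ⊗[K] H}
    (hR : IsQuasiTriangular K H R) (x : H) :
    alphaTilde K H α R * rightEval α.toLinearMap R * x =
      x * (alphaTilde K H α R * rightEval α.toLinearMap R) := by
  let e : H ⊗[K] H →ₐ[K] H :=
    (Algebra.TensorProduct.lid K H).toAlgHom.comp (Algebra.TensorProduct.map α (AlgHom.id K H))
  have heR : e R = alphaTilde K H α R := rfl
  have heR' : e (Algebra.TensorProduct.comm K H H R) = rightEval α.toLinearMap R := by
    obtain ⟨s, rfl⟩ := TensorProduct.exists_finset R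
    simp [e, rightEval_sum]
  let f : WithConv (H →ₗ[K] H) :=
    toConv LinearMap.id * toConv ((Algebra.ofId K H).comp α).toLinearMap
  have hf (y : H) : e (Algebra.TensorProduct.comm K H H (comul (R := K) y)) = f y := by
    rw [(ℛ K y).convMul_apply, ← (ℛ K y).eq]
    simp [e, Algebra.ofId_apply, ← Algebra.commutes, ← Algebra.smul_def]
  have hcomm (y : H) : alphaTilde K H α R * rightEval α.toLinearMap R * f y =
      f y * (alphaTilde K H α R * rightEval α.toLinearMap R) := by
    have h1 : R * comul y = Algebra.TensorProduct.comm K H H (comul (R := K) y) * R :=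
      hR.intertwine y
    have h2 := congr(Algebra.TensorProduct.comm K H H $h1)
    simp only [map_mul] at h2
    have h3 : Algebra.TensorProduct.comm K H H
        (Algebra.TensorProduct.comm K H H (comul (R := K) y)) = comul y :=
      TensorProduct.comm_comm _ _ _ _
    rw [h3] at h2
    rw [← heR, ← heR', ← hf, ← map_mul, ← map_mul, ← map_mul, mul_assoc, h2, ← mul_assoc, h1,
      mul_assoc]
  let g : WithConv (H →ₗ[K] H) :=
    toConv LinearMap.id * toConv (((Algebra.ofId K H).comp α).toLinearMap ∘ₗ antipode K)
  have hfg : f (g x) = x := by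
    have h : f * toConv (((Algebra.ofId K H).comp α).toLinearMap ∘ₗ antipode K) =
        toConv LinearMap.id := by
      rw [mul_assoc, toConv_algHom_mul_antipode, mul_one]
    have hx := congr($h x)
    rw [(ℛ K x).convMul_apply] at hx
    rw [(ℛ K x).convMul_apply]
    refine Eq.trans ?_ hx
    change f.ofConv _ = _
    rw [map_sum]
    refine Finset.sum_congr rfl fun i _ => ?_
    simp only [LinearMap.comp_apply, AlgHom.toLinearMap_apply, AlgHom.comp_apply,
      Algebra.ofId_apply, ← Algebra.commutes, ← Algebra.smul_def, map_smul]
    rfl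
  rw [← hfg, hcomm]

end Character

section Integral

variable {Λ : H}

lemma tmul_one_eq_sum_antipode (x : H) :
    ∑ i ∈ (ℛ K x).index, (antipode K ((ℛ K x).left i) ⊗ₜ[K] (1 : H)) *
      comul (R := K) ((ℛ K x).right i) = 1 ⊗ₜ[K] x := by
  have h : toConv ((includeLeft : H →ₐ[K] H ⊗[K] H).toLinearMap ∘ₗ antipode K) *
      toConv (comul (R := K) (A := H)) =
      toConv (includeRight : H →ₐ[K] H ⊗[K] H).toLinearMap := by
    rw [toConv_comul, ← mul_assoc, toConv_algHom_antipode_mul, one_mul]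
  have hx := congr($h x)
  rw [(ℛ K x).convMul_apply] at hx
  exact hx

lemma IsLeftIntegral.one_tmul_mul_comul (hΛ : IsLeftIntegral K H Λ) (x : H) :
    (1 : H) ⊗ₜ[K] x * comul (R := K) Λ = (antipode K x ⊗ₜ[K] (1 : H)) * comul (R := K) Λ := by
  have h2 := congr(antipode K $(sum_counit_smul_left (ℛ K x)))
  rw [← tmul_one_eq_sum_antipode x, ← h2, Finset.sum_mul]
  simp only [mul_assoc, ← Bialgebra.comul_mul, hΛ _]
  simp [TensorProduct.sum_tmul, Finset.sum_mul, ← TensorProduct.smul_tmul']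

lemma comul_mul_one_tmul_antipode {α : H →ₐ[K] K} (hα : ∀ x : H, Λ * x = α x • Λ) (x : H) :
    comul (R := K) Λ * ((1 : H) ⊗ₜ[K] antipode K x) =
      comul (R := K) Λ * (antipodeTwist α x ⊗ₜ[K] (1 : H)) := by
  let i₂ : WithConv (H →ₗ[K] H ⊗[K] H) :=
    toConv ((includeRight : H →ₐ[K] H ⊗[K] H).toLinearMap ∘ₗ antipode K)
  let η : H →ₐ[K] H ⊗[K] H := (Algebra.ofId K (H ⊗[K] H)).comp α
  have h1 : toConv (includeLeft : H →ₐ[K] H ⊗[K] H).toLinearMap =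
      toConv (comul (R := K) (A := H)) * i₂ := by
    rw [toConv_comul, mul_assoc, toConv_algHom_mul_antipode, mul_one]
  have h2 (y : H) : comul (R := K) Λ * (y ⊗ₜ[K] (1 : H)) =
      comul (R := K) Λ * (toConv η.toLinearMap * i₂) y := by
    have hy : y ⊗ₜ[K] (1 : H) = (toConv (comul (R := K) (A := H)) * i₂) y := congr($h1 y)
    rw [hy, (ℛ K y).convMul_apply, (ℛ K y).convMul_apply, Finset.mul_sum, Finset.mul_sum]
    refine Finset.sum_congr rfl fun i _ => ?_
    rw [← mul_assoc]
    change comul (R := K) Λ * comul (R := K) _ * _ = _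
    rw [← Bialgebra.comul_mul, hα]
    change comul (R := K) (α _ • Λ) * _ = comul (R := K) Λ * (algebraMap K _ (α _) * _)
    rw [← Algebra.smul_def, mul_smul_comm, map_smul, smul_mul_assoc]
  have h3 : toConv (η.toLinearMap ∘ₗ antipode K) * (toConv η.toLinearMap * i₂) = i₂ := by
    rw [← mul_assoc, toConv_algHom_antipode_mul, one_mul]
  have hx : (1 : H) ⊗ₜ[K] antipode K x =
      (toConv (η.toLinearMap ∘ₗ antipode K) * (toConv η.toLinearMap * i₂)) x := by
    rw [h3]; rfl
  rw [hx, (ℛ K x).convMul_apply, antipodeTwist_apply, TensorProduct.sum_tmul, Finset.mul_sum,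
    Finset.mul_sum]
  refine Finset.sum_congr rfl fun i _ => ?_
  rw [← TensorProduct.smul_tmul', mul_smul_comm, h2]
  change comul (R := K) Λ * (algebraMap K _ (α _) * _) = _
  rw [← Algebra.smul_def, mul_smul_comm]

lemma IsQuasiTriangular.mul_comul_integral (hR : IsQuasiTriangular K H (∑ i ∈ s, a i ⊗ₜ b i))
    (hΛ : IsLeftIntegral K H Λ) :
    (∑ i ∈ s, a i ⊗ₜ b i) * comul (R := K) Λ =
      (antipode K (drinfeldU K H (∑ i ∈ s, a i ⊗ₜ b i)) ⊗ₜ[K] (1 : H)) * comul (R := K) Λ := by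
  rw [hR.antipode_drinfeldU, TensorProduct.sum_tmul, Finset.sum_mul, Finset.sum_mul]
  refine Finset.sum_congr rfl fun i _ => ?_
  have h1 : a i ⊗ₜ[K] b i = (a i ⊗ₜ[K] (1 : H)) * ((1 : H) ⊗ₜ b i) := by simp
  rw [h1, mul_assoc, hΛ.one_tmul_mul_comul, ← mul_assoc]
  simp

lemma IsQuasiTriangular.comul_integral_mul (hR : IsQuasiTriangular K H (∑ i ∈ s, a i ⊗ₜ b i))
    {α : H →ₐ[K] K} (hα : ∀ x : H, Λ * x = α x • Λ) :
    comul (R := K) Λ * (∑ i ∈ s, b i ⊗ₜ a i) =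
      comul (R := K) Λ * ((antipode K (drinfeldU K H (∑ i ∈ s, a i ⊗ₜ b i)) *
        alphaTilde K H α (∑ i ∈ s, a i ⊗ₜ b i)) ⊗ₜ[K] (1 : H)) := by
  have h := congr(TensorProduct.comm K H H $(hR.sum_antipode_tmul_antipode))
  simp only [map_sum, TensorProduct.comm_tmul] at h
  rw [← h, ← hR.sum_antipodeTwist_mul_antipode, TensorProduct.sum_tmul, Finset.mul_sum,
    Finset.mul_sum]
  refine Finset.sum_congr rfl fun i _ => ?_
  have h1 : antipode K (b i) ⊗ₜ[K] antipode K (a i) =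
      ((1 : H) ⊗ₜ[K] antipode K (a i)) * (antipode K (b i) ⊗ₜ[K] (1 : H)) := by simp
  rw [h1, ← mul_assoc, comul_mul_one_tmul_antipode hα, mul_assoc]
  simp

lemma tmul_one_mul_comm {x : H} (hx : ∀ y, x * y = y * x) (X : H ⊗[K] H) :
    (x ⊗ₜ[K] (1 : H)) * X = X * (x ⊗ₜ[K] (1 : H)) := by
  induction X with
  | zero => simp
  | tmul y z => simp [hx]
  | add y z hy hz => rw [mul_add, add_mul, hy, hz]

lemma IsQuasiTriangular.sum_mul_antipode_drinfeldU_mul [FiniteDimensional K H]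
    (hR : IsQuasiTriangular K H (∑ i ∈ s, a i ⊗ₜ b i)) :
    ∑ i ∈ s, b i * antipode K (drinfeldU K H (∑ i ∈ s, a i ⊗ₜ b i)) * antipode K (a i) =
      drinfeldU K H (∑ i ∈ s, a i ⊗ₜ b i) *
        antipode K (drinfeldU K H (∑ i ∈ s, a i ⊗ₜ b i)) := by
  have h := congr(mul' K H (TensorProduct.map
    (mulRight K (antipode K (drinfeldU K H (∑ i ∈ s, a i ⊗ₜ b i)))) (antipode K)
    (TensorProduct.comm K H H $(hR.sum_antipode_tmul_antipode))))
  simp only [map_sum, TensorProduct.comm_tmul, TensorProduct.map_tmul, mulRight_apply,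
    mul'_apply] at h
  rw [← h]
  nth_rw 2 [drinfeldU_sum]
  rw [Finset.sum_mul]
  refine Finset.sum_congr rfl fun i _ => ?_
  rw [mul_assoc, hR.antipode_drinfeldU_mul, mul_assoc]

/-- The grouplike element `(α ⊗ id)(R R₂₁)` acts trivially on the coproduct of an integral. -/
lemma IsQuasiTriangular.monodromy_mul_comul_integral [FiniteDimensional K H] {R : H ⊗[K] H}
    (hR : IsQuasiTriangular K H R) (hΛ : IsLeftIntegral K H Λ)
    {α : H →ₐ[K] K} (hα : ∀ x : H, Λ * x = α x • Λ) :
    ((alphaTilde K H α R * rightEval α.toLinearMap R) ⊗ₜ[K] (1 : H)) * comul (R := K) Λ =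
      comul (R := K) Λ := by
  obtain ⟨s, rfl⟩ := TensorProduct.exists_finset R
  have hinv := hR.antipode_rightEval α
  have htw := hR.sum_tmul_antipodeTwist α
  have hg := hR.alphaTilde_mul_rightEval_comm α
  have hmul := hR.mul_comul_integral hΛ
  have hmul' := hR.comul_integral_mul hα
  have hsum := hR.sum_mul_antipode_drinfeldU_mul
  have hint := hR.intertwine Λ
  have hc := hR.drinfeldU_mul_antipode_comm
  have hSS := hR.sum_antipode_tmul_antipode
  have hu : IsUnit (drinfeldU K H (∑ i ∈ s, i.1 ⊗ₜ i.2) *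
      antipode K (drinfeldU K H (∑ i ∈ s, i.1 ⊗ₜ i.2))) :=
    hR.isUnit_drinfeldU.mul
      (by simpa using (hR.isUnit_drinfeldU.map (antipodeAlgHomOp K H)).unop)
  set R := ∑ i ∈ s, i.1 ⊗ₜ[K] i.2
  set u := drinfeldU K H R
  set t := alphaTilde K H α R
  set γ := rightEval α.toLinearMap R
  set β := rightEval (α.toLinearMap ∘ₗ antipode K) R
  set L := comul (R := K) Λ
  have hL : (∑ i ∈ s, i.2 ⊗ₜ[K] i.1) * R * L = ((u * antipode K u) ⊗ₜ[K] (1 : H)) * L := by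
    rw [mul_assoc, hmul, ← mul_assoc, Finset.sum_mul, Finset.sum_mul, ← hsum,
      TensorProduct.sum_tmul, Finset.sum_mul]
    refine Finset.sum_congr rfl fun i _ => ?_
    have h1 : (i.2 ⊗ₜ[K] i.1) * (antipode K u ⊗ₜ[K] (1 : H)) =
      ((i.2 * antipode K u) ⊗ₜ[K] (1 : H)) * ((1 : H) ⊗ₜ[K] i.1) := by simp
    rw [h1, mul_assoc, hΛ.one_tmul_mul_comul, ← mul_assoc,
      Algebra.TensorProduct.tmul_mul_tmul, one_mul]
  have hL' : L * (∑ i ∈ s, i.2 ⊗ₜ[K] i.1) * R =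
      L * ((u * antipode K u * (t * γ)) ⊗ₜ[K] (1 : H)) := by
    have h1 : L * (∑ i ∈ s, i.2 ⊗ₜ[K] i.1) * R = L * ∑ i ∈ s,
        (antipodeTwist α i.2 * (antipode K u * t) * antipode K i.1) ⊗ₜ[K] (1 : H) := by
      rw [hmul', ← hSS, Finset.mul_sum, Finset.mul_sum]
      refine Finset.sum_congr rfl fun i _ => ?_
      have h2 : ((antipode K u * t) ⊗ₜ[K] (1 : H)) * (antipode K i.1 ⊗ₜ[K] antipode K i.2) =
        ((1 : H) ⊗ₜ[K] antipode K i.2) *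
          ((antipode K u * t * antipode K i.1) ⊗ₜ[K] (1 : H)) := by simp
      rw [mul_assoc, h2, ← mul_assoc, comul_mul_one_tmul_antipode hα, mul_assoc,
        Algebra.TensorProduct.tmul_mul_tmul, one_mul]
      simp only [mul_assoc]
      rfl
    have h3 := congr(mul' K H (TensorProduct.map (mulRight K (antipode K u * t)) (antipode K)
      (TensorProduct.comm K H H $htw)))
    simp only [map_sum, TensorProduct.comm_tmul, TensorProduct.map_tmul, mulRight_apply,
      mul'_apply, antipode_mul_antidistrib, hinv] at h3
    rw [h1, ← TensorProduct.sum_tmul, h3, ← hsum, Finset.sum_mul]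
    refine congrArg (fun z => L * (z ⊗ₜ[K] (1 : H))) (Finset.sum_congr rfl fun i _ => ?_)
    calc i.2 * (antipode K u * t) * (γ * antipode K i.1)
        = i.2 * antipode K u * ((t * γ) * antipode K i.1) := by simp only [mul_assoc]
      _ = i.2 * antipode K u * antipode K i.1 * (t * γ) := by rw [hg]; simp only [mul_assoc]
  have hRt : TensorProduct.comm K H H R = ∑ i ∈ s, i.2 ⊗ₜ[K] i.1 := by simp [R]
  have hint' : (∑ i ∈ s, i.2 ⊗ₜ[K] i.1) * TensorProduct.comm K H H L =
      L * ∑ i ∈ s, i.2 ⊗ₜ[K] i.1 := by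
    have h := congr(Algebra.TensorProduct.comm K H H $hint)
    rw [map_mul, map_mul] at h
    have h2 : Algebra.TensorProduct.comm K H H (TensorProduct.comm K H H L) = L :=
      TensorProduct.comm_comm _ _ _ _
    rw [h2] at h
    rw [← hRt]
    exact h
  have key : ((u * antipode K u) ⊗ₜ[K] (1 : H)) * L =
      ((u * antipode K u) ⊗ₜ[K] (1 : H)) * (((t * γ) ⊗ₜ[K] (1 : H)) * L) := by
    rw [← hL, mul_assoc, hint, ← mul_assoc, hint', hL', ← tmul_one_mul_comm, ← mul_assoc]
    · simp only [← mul_assoc, Algebra.TensorProduct.tmul_mul_tmul, one_mul]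
    · intro y
      rw [mul_assoc, hg, ← mul_assoc, hc, mul_assoc]
  exact ((hu.map (includeLeft : H →ₐ[K] H ⊗[K] H)).mul_left_cancel key).symm

lemma IsQuasiTriangular.alphaTilde_mul_comul_integral [FiniteDimensional K H] {R : H ⊗[K] H}
    (hR : IsQuasiTriangular K H R) (hΛ : IsLeftIntegral K H Λ)
    {α : H →ₐ[K] K} (hα : ∀ x : H, Λ * x = α x • Λ) (x : H) :
    ((alphaTilde K H α R * x) ⊗ₜ[K] (1 : H)) * comul (R := K) Λ =
      ((rightEval (α.toLinearMap ∘ₗ antipode K) R * x) ⊗ₜ[K] (1 : H)) * comul (R := K) Λ := by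
  have hm := hR.monodromy_mul_comul_integral hΛ hα
  have hg := hR.alphaTilde_mul_rightEval_comm α
  have hb : rightEval α.toLinearMap R * rightEval (α.toLinearMap ∘ₗ antipode K) R = 1 := by
    have : IsArtinianRing H := IsArtinianRing.of_finite K H
    obtain ⟨s, rfl⟩ := TensorProduct.exists_finset R
    exact mul_eq_one_symm (hR.rightEval_mul_rightEval α)
  have ht : alphaTilde K H α R = alphaTilde K H α R * rightEval α.toLinearMap R *
      rightEval (α.toLinearMap ∘ₗ antipode K) R := by rw [mul_assoc, hb, mul_one]
  rw [ht, mul_assoc, hg]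
  nth_rw 2 [← hm]
  simp only [← mul_assoc, Algebra.TensorProduct.tmul_mul_tmul, one_mul]

end Integral

section Transmutation

lemma adMap_tmul (x r : H) :
    adMap K H (x ⊗ₜ r) = (toConv (mulRight K r) * toConv (antipode K) : WithConv (H →ₗ[K] H)) x := by
  rw [(ℛ K x).convMul_apply]
  simp [adMap, ← (ℛ K x).eq, TensorProduct.sum_tmul, mul_assoc]

lemma IsQuasiTriangular.deltaR_apply (hR : IsQuasiTriangular K H (∑ i ∈ s, a i ⊗ₜ b i)) (h : H) :
    deltaR K H (∑ i ∈ s, a i ⊗ₜ b i) h = ∑ i ∈ s, ((1 : H) ⊗ₜ[K] a i) *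
      (comul (R := K) h * ∑ j ∈ s, b j ⊗ₜ[K] a j) * (antipode K (b i) ⊗ₜ[K] (1 : H)) := by
  have key (l r : H) : ∑ i ∈ s, (l * antipode K (b i)) ⊗ₜ[K] adMap K H (a i ⊗ₜ r) =
      ∑ i ∈ s, ((1 : H) ⊗ₜ[K] a i) * ((l ⊗ₜ[K] r) * ∑ j ∈ s, b j ⊗ₜ[K] a j) *
        (antipode K (b i) ⊗ₜ[K] (1 : H)) := by
    have h := congr(TensorProduct.map (mulLeft K l ∘ₗ antipode K) LinearMap.id
      (TensorProduct.comm K H H $(hR.sum_conv_tmul (mulRight K r) (antipode K))))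
    simp only [map_sum, TensorProduct.comm_tmul, TensorProduct.map_tmul, LinearMap.id_apply,
      LinearMap.comp_apply, mulLeft_apply, mulRight_apply, antipode_mul_antidistrib] at h
    simp only [adMap_tmul]
    refine h.trans (Finset.sum_congr rfl fun i _ => ?_)
    have h2 := congr(TensorProduct.comm K H H $(hR.sum_antipode_tmul_antipode))
    simp only [map_sum, TensorProduct.comm_tmul] at h2
    rw [← h2]
    simp [Finset.mul_sum, Finset.sum_mul, mul_assoc]
  conv_rhs => rw [← (ℛ K h).eq]
  simp only [Finset.sum_mul _ _ (∑ j ∈ s, _), Finset.mul_sum (ℛ K h).index,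
    Finset.sum_mul (ℛ K h).index]
  rw [Finset.sum_comm]
  simp only [← key]
  rw [Finset.sum_comm]
  simp [deltaR, ← (ℛ K h).eq]

/-- The endomorphism `X ↦ Σ (p ⊗ 1) X (q ⊗ 1)` of `H ⊗ H` attached to `Σ p ⊗ q`. -/
noncomputable def leftSandwich (X : H ⊗[K] H) : H ⊗[K] H →ₗ[K] H ⊗[K] H :=
  mul' K (H ⊗[K] H) ∘ₗ TensorProduct.map
    (mulRight K X ∘ₗ (includeLeft : H →ₐ[K] H ⊗[K] H).toLinearMap)
    (includeLeft : H →ₐ[K] H ⊗[K] H).toLinearMap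

lemma leftSandwich_tmul (X : H ⊗[K] H) (p q : H) :
    leftSandwich X (p ⊗ₜ q) = (p ⊗ₜ[K] (1 : H)) * X * (q ⊗ₜ[K] (1 : H)) := by
  simp [leftSandwich]

lemma IsQuasiTriangular.leftSandwich_injective {R : H ⊗[K] H} (hR : IsQuasiTriangular K H R)
    {X Y : H ⊗[K] H} (h : leftSandwich X R = leftSandwich Y R) : X = Y := by
  obtain ⟨s, rfl⟩ := TensorProduct.exists_finset R
  have key (Z : H ⊗[K] H) : ∑ i ∈ s, (i.1 ⊗ₜ[K] (1 : H)) *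
      leftSandwich Z (∑ j ∈ s, j.1 ⊗ₜ j.2) * (antipode K i.2 ⊗ₜ[K] (1 : H)) = Z := by
    have h := congr(leftSandwich Z $(hR.sum_tmul_mul_antipode))
    have h1 : leftSandwich Z 1 = Z := by
      rw [Algebra.TensorProduct.one_def, leftSandwich_tmul, ← Algebra.TensorProduct.one_def,
        one_mul, mul_one]
    rw [h1] at h
    refine Eq.trans ?_ h
    simp only [map_sum, leftSandwich_tmul, Finset.mul_sum, Finset.sum_mul]
    refine Finset.sum_congr rfl fun i _ => Finset.sum_congr rfl fun j _ => ?_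
    have h2 (x y : H) : (x * y) ⊗ₜ[K] (1 : H) = (x ⊗ₜ[K] (1 : H)) * (y ⊗ₜ[K] (1 : H)) := by simp
    rw [h2, h2]
    simp only [mul_assoc]
  rw [← key X, ← key Y, h]

variable {Λ : H}

lemma IsQuasiTriangular.deltaR_integral {R : H ⊗[K] H} (hR : IsQuasiTriangular K H R)
    (hΛ : IsLeftIntegral K H Λ) {α : H →ₐ[K] K} (hα : ∀ x : H, Λ * x = α x • Λ) :
    deltaR K H R Λ = leftSandwich (comul (R := K) Λ *
      ((antipode K (drinfeldU K H R) * alphaTilde K H α R) ⊗ₜ[K] (1 : H))) R := by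
  obtain ⟨s, rfl⟩ := TensorProduct.exists_finset R
  rw [hR.deltaR_apply, hR.comul_integral_mul hα]
  refine Eq.trans ?_ congr(leftSandwich _ $(hR.sum_antipode_tmul_antipode))
  rw [map_sum]
  refine Finset.sum_congr rfl fun i _ => ?_
  rw [leftSandwich_tmul, ← mul_assoc, hΛ.one_tmul_mul_comul, ← mul_assoc]

lemma IsQuasiTriangular.comm_deltaR_integral {R : H ⊗[K] H} (hR : IsQuasiTriangular K H R)
    (hΛ : IsLeftIntegral K H Λ) {α : H →ₐ[K] K} (hα : ∀ x : H, Λ * x = α x • Λ) :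
    TensorProduct.comm K H H (deltaR K H R Λ) =
      leftSandwich (((rightEval (α.toLinearMap ∘ₗ antipode K) R *
        antipode K (drinfeldU K H R)) ⊗ₜ[K] (1 : H)) * comul (R := K) Λ) R := by
  obtain ⟨s, rfl⟩ := TensorProduct.exists_finset R
  have hcomm : Algebra.TensorProduct.comm K H H (comul (R := K) Λ *
      ∑ j ∈ s, j.2 ⊗ₜ[K] j.1) =
      ((antipode K (drinfeldU K H (∑ j ∈ s, j.1 ⊗ₜ j.2))) ⊗ₜ[K] (1 : H)) * comul (R := K) Λ := by
    rw [← hR.mul_comul_integral hΛ, hR.intertwine, map_mul]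
    simp
    rfl
  have h := congr(leftSandwich (((antipode K (drinfeldU K H (∑ j ∈ s, j.1 ⊗ₜ j.2))) ⊗ₜ[K]
    (1 : H)) * comul (R := K) Λ) $(hR.sum_tmul_antipodeTwist α))
  simp only [map_sum, leftSandwich_tmul] at h
  change Algebra.TensorProduct.comm K H H _ = _
  rw [hR.deltaR_apply, map_sum, map_sum]
  have h2 (x y : H) : (x * y) ⊗ₜ[K] (1 : H) = (x ⊗ₜ[K] (1 : H)) * (y ⊗ₜ[K] (1 : H)) := by simp
  simp only [leftSandwich_tmul]
  simp only [h2, mul_assoc] at h ⊢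
  rw [← h]
  refine Finset.sum_congr rfl fun i _ => ?_
  rw [← mul_assoc (comul (R := K) Λ), map_mul, map_mul, hcomm, mul_assoc,
    ← comul_mul_one_tmul_antipode hα]
  simp

end Transmutation

lemma rTensor_mulRight_apply (y : H) (X : H ⊗[K] H) :
    rTensor H (mulRight K y) X = X * (y ⊗ₜ[K] (1 : H)) := by
  induction X with
  | zero => simp
  | tmul p q => simp
  | add p q hp hq => rw [map_add, hp, hq, add_mul]

lemma rTensor_mulLeft_apply (y : H) (X : H ⊗[K] H) :
    rTensor H (mulLeft K y) X = (y ⊗ₜ[K] (1 : H)) * X := by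
  induction X with
  | zero => simp
  | tmul p q => simp
  | add p q hp hq => rw [map_add, hp, hq, mul_add]

end Convolution

/-- Let `(H,R)` be a finite dimensional quasi-triangular Hopf algebra,
`Λ` a left integral for `H`, `α` the distinguished grouplike element of `H*`,
`u = Σ S(R²)R¹` the Drinfeld element and `α̃ = (α⊗id)(R)`.  Then
`Δ_R(Λ)` is symmetric, i.e. `Σ Λ⁽¹⁾⊗Λ⁽²⁾ = Σ Λ⁽²⁾⊗Λ⁽¹⁾`, if and only if
`Σ Λ₍₁₎ S(u) α̃ ⊗ Λ₍₂₎ = Σ α̃ S(u) Λ₍₁₎ ⊗ Λ₍₂₎`. -/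
theorem deltaR_integral_symm_iff [FiniteDimensional K H]
    (R : H ⊗[K] H) (hR : IsQuasiTriangular K H R)
    (Λ : H) (hΛ : IsLeftIntegral K H Λ)
    (α : H →ₐ[K] K)
    (hα : ∀ Λ' : H, IsLeftIntegral K H Λ' → ∀ h : H, Λ' * h = (α h) • Λ') :
    deltaR K H R Λ = (TensorProduct.comm K H H) (deltaR K H R Λ) ↔
      LinearMap.rTensor H (LinearMap.mulRight K
          (HopfAlgebra.antipode (R := K) (drinfeldU K H R) * alphaTilde K H α R))
        (Coalgebra.comul (R := K) Λ)
      = LinearMap.rTensor H (LinearMap.mulLeft K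
          (alphaTilde K H α R * HopfAlgebra.antipode (R := K) (drinfeldU K H R)))
        (Coalgebra.comul (R := K) Λ) := by
  have hα' := hα Λ hΛ
  rw [rTensor_mulRight_apply, rTensor_mulLeft_apply, hR.alphaTilde_mul_comul_integral hΛ hα',
    hR.comm_deltaR_integral hΛ hα', hR.deltaR_integral hΛ hα']
  exact ⟨hR.leftSandwich_injective, fun h => by rw [h]⟩
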